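/- Perturbation of quantiles (Lemma 3.5): For any c₁ > 0 there exists c* = c*(c₁) > 0 such that the following holds. Let B, A be deterministic Hermitian N×N matrices with ‖B‖ ≤ C₀, ‖A‖ ≤ C, and let ρ^x be the self-consistent density of states of B + xA with quantiles γ_i^x. For any x₁, x₂ with |x₁ − x₂| ≤ c* and any index i in the c₁-bulk for both parameters (ρ^{x_r}(γ_i^{x_r}) ≥ c₁ for r = 1, 2), one has γ_i^{x₁} = γ_i^{x₂} + (x₁ − x₂)⟨A⟩ + O(|x₁ − x₂| ⟨Å²⟩^{1/2} + |x₁ − x₂|²), i.e. |γ_i^{x₁} − γ_i^{x₂} − (x₁ − x₂)⟨A⟩| ≤ C'(|x₁ − x₂| ⟨Å²⟩^{1/2} + |x₁ − x₂|²) with C' depending only on c₁ and the model constants. -/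

import Mathlib

open MeasureTheory Matrix Polynomial Filter ProbabilityTheory
open scoped BigOperators ComplexOrder

noncomputable section

/-- Normalized trace `⟨R⟩ = N⁻¹ Tr R`. -/
def ntr (N : ℕ) (R : Matrix (Fin N) (Fin N) ℂ) : ℂ := (N : ℂ)⁻¹ * R.trace

/-- Imaginary part of a matrix, `Im M = (M - M*)/(2i)`. -/
def imP (N : ℕ) (M : Matrix (Fin N) (Fin N) ℂ) : Matrix (Fin N) (Fin N) ℂ :=
  (2 * Complex.I)⁻¹ • (M - Mᴴ)

/-- Traceless part `Å = A - ⟨A⟩`. -/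
def ringed (N : ℕ) (A : Matrix (Fin N) (Fin N) ℂ) : Matrix (Fin N) (Fin N) ℂ :=
  A - ntr N A • (1 : Matrix (Fin N) (Fin N) ℂ)

/-- `⟨Å²⟩` as a real number. -/
def ringedSq (N : ℕ) (A : Matrix (Fin N) (Fin N) ℂ) : ℝ :=
  (ntr N (ringed N A * ringed N A)).re

/-- Euclidean operator norm of a matrix. -/
def opNorm (N : ℕ) (M : Matrix (Fin N) (Fin N) ℂ) : ℝ :=
  ‖(LinearMap.toContinuousLinearMap (Matrix.toEuclideanLin M))‖

/-- `Msol x z` solves the Matrix Dyson Equation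
`-M⁻¹ = z - B - xA + ⟨M⟩` with positive definite imaginary part, for `Im z > 0`. -/
def IsMDESol (N : ℕ) (B A : Matrix (Fin N) (Fin N) ℂ)
    (Msol : ℝ → ℂ → Matrix (Fin N) (Fin N) ℂ) : Prop :=
  ∀ x : ℝ, ∀ z : ℂ, 0 < z.im →
    (-(Msol x z)⁻¹ = z • (1 : Matrix (Fin N) (Fin N) ℂ) - B - x • A
        + ntr N (Msol x z) • (1 : Matrix (Fin N) (Fin N) ℂ))
    ∧ (imP N (Msol x z)).PosDef

/-- `ρ x` is the self-consistent density of states associated with `Msol x`. -/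
def IsSCDos (N : ℕ) (Msol : ℝ → ℂ → Matrix (Fin N) (Fin N) ℂ) (ρ : ℝ → ℝ → ℝ) : Prop :=
  ∀ x E : ℝ, Filter.Tendsto
    (fun η : ℝ => (Real.pi)⁻¹ * (ntr N (imP N (Msol x (E + η * Complex.I)))).re)
    (nhdsWithin 0 (Set.Ioi 0)) (nhds (ρ x E))

/-- `γ x i` is the `i`-th quantile of the density `ρ x` (`i ∈ [N]`, 1-based). -/
def IsQuantile (N : ℕ) (ρ : ℝ → ℝ → ℝ) (γ : ℝ → ℕ → ℝ) : Prop :=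
  ∀ x : ℝ, ∀ i : ℕ, 1 ≤ i → i ≤ N → ∫ t in Set.Iic (γ x i), ρ x t = i / N

/-- In the bulk, `Msol x` extends continuously to the real axis. -/
def MDEExtendsToBulk (N : ℕ) (Msol : ℝ → ℂ → Matrix (Fin N) (Fin N) ℂ)
    (ρ : ℝ → ℝ → ℝ) (c₁ : ℝ) : Prop :=
  ∀ x E : ℝ, c₁ ≤ ρ x E → Filter.Tendsto (fun η : ℝ => Msol x (E + η * Complex.I))
    (nhdsWithin 0 (Set.Ioi 0)) (nhds (Msol x (E : ℂ)))

def hsq (N : ℕ) (R : Matrix (Fin N) (Fin N) ℂ) : ℝ := (N : ℝ)⁻¹ * ∑ i, ∑ j, ‖R i j‖ ^ 2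

lemma hsq_nonneg (N : ℕ) (R : Matrix (Fin N) (Fin N) ℂ) : 0 ≤ hsq N R := by
  unfold hsq; positivity

lemma hsq_conjT (N : ℕ) (R : Matrix (Fin N) (Fin N) ℂ) : hsq N Rᴴ = hsq N R := by
  unfold hsq; rw [Finset.sum_comm]; simp [Matrix.conjTranspose_apply]

lemma hsq_one (N : ℕ) (hN : 1 ≤ N) : hsq N 1 = 1 := by
  have : (N : ℝ) ≠ 0 := by positivity
  unfold hsq
  have h : ∀ i : Fin N, ∑ j, ‖(1 : Matrix (Fin N) (Fin N) ℂ) i j‖ ^ 2 = 1 := by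
    intro i
    rw [Finset.sum_eq_single i] <;> simp +contextual [Matrix.one_apply, eq_comm]
  simp [h, this]

lemma ntr_mul_sq_le (N : ℕ) (R S : Matrix (Fin N) (Fin N) ℂ) :
    ‖ntr N (R * S)‖ ^ 2 ≤ hsq N R * hsq N S := by
  have h1 : ‖(R * S).trace‖ ≤ ∑ p : Fin N × Fin N, ‖R p.1 p.2‖ * ‖S p.2 p.1‖ := by
    rw [Matrix.trace, Fintype.sum_prod_type]
    refine (norm_sum_le _ _).trans (Finset.sum_le_sum fun i _ => ?_)
    rw [Matrix.diag_apply, Matrix.mul_apply]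
    refine (norm_sum_le _ _).trans (le_of_eq ?_)
    simp
  have h2 := Finset.sum_mul_sq_le_sq_mul_sq Finset.univ
    (fun p : Fin N × Fin N => ‖R p.1 p.2‖) (fun p => ‖S p.2 p.1‖)
  have h3 : ∑ p : Fin N × Fin N, ‖R p.1 p.2‖ ^ 2 = ∑ i, ∑ j, ‖R i j‖ ^ 2 :=
    Fintype.sum_prod_type _
  have h4 : ∑ p : Fin N × Fin N, ‖S p.2 p.1‖ ^ 2 = ∑ i, ∑ j, ‖S i j‖ ^ 2 := by
    rw [Fintype.sum_prod_type, Finset.sum_comm]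
  rw [h3, h4] at h2
  unfold ntr hsq
  rw [norm_mul, mul_pow]
  have h5 : ‖(R * S).trace‖ ^ 2 ≤ (∑ i, ∑ j, ‖R i j‖ ^ 2) * ∑ i, ∑ j, ‖S i j‖ ^ 2 :=
    (pow_le_pow_left₀ (norm_nonneg _) h1 2).trans h2
  have h6 : ‖(N : ℂ)⁻¹‖ ^ 2 = (N : ℝ)⁻¹ * (N : ℝ)⁻¹ := by simp [sq]
  rw [h6]
  calc _ ≤ (N : ℝ)⁻¹ * (N : ℝ)⁻¹ * ((∑ i, ∑ j, ‖R i j‖ ^ 2) * ∑ i, ∑ j, ‖S i j‖ ^ 2) := by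
        gcongr
    _ = _ := by ring

lemma ntr_sq_le (N : ℕ) (hN : 1 ≤ N) (R : Matrix (Fin N) (Fin N) ℂ) :
    ‖ntr N R‖ ^ 2 ≤ hsq N R := by
  have := ntr_mul_sq_le N R 1
  rwa [hsq_one N hN, mul_one, mul_one] at this

lemma hsq_eq (N : ℕ) (R : Matrix (Fin N) (Fin N) ℂ) : ntr N (R * Rᴴ) = (hsq N R : ℂ) := by
  unfold ntr hsq
  simp only [Matrix.trace, Matrix.diag_apply, Matrix.mul_apply, Matrix.conjTranspose_apply]
  push_cast
  congr 1
  refine Finset.sum_congr rfl fun i _ => Finset.sum_congr rfl fun j _ => ?_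
  exact Complex.mul_conj' _

lemma ntr_sub (N : ℕ) (R S : Matrix (Fin N) (Fin N) ℂ) : ntr N (R - S) = ntr N R - ntr N S := by
  simp [ntr, mul_sub]
lemma ntr_add (N : ℕ) (R S : Matrix (Fin N) (Fin N) ℂ) : ntr N (R + S) = ntr N R + ntr N S := by
  simp [ntr, mul_add]
lemma ntr_smul (N : ℕ) (c : ℂ) (R : Matrix (Fin N) (Fin N) ℂ) : ntr N (c • R) = c * ntr N R := by
  simp [ntr, mul_left_comm]
lemma ntr_rsmul (N : ℕ) (c : ℝ) (R : Matrix (Fin N) (Fin N) ℂ) : ntr N (c • R) = c * ntr N R := by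
  simp [ntr, mul_left_comm]
lemma ntr_conjT (N : ℕ) (R : Matrix (Fin N) (Fin N) ℂ) : ntr N Rᴴ = star (ntr N R) := by
  simp [ntr]
lemma ntr_comm (N : ℕ) (R S : Matrix (Fin N) (Fin N) ℂ) : ntr N (R * S) = ntr N (S * R) := by
  simp [ntr, Matrix.trace_mul_comm R S]
lemma ntr_one (N : ℕ) (hN : 1 ≤ N) : ntr N 1 = 1 := by
  have : (N : ℂ) ≠ 0 := by norm_cast; omega
  simp [ntr, this]

lemma hsq_sub_conjT (N : ℕ) (R S : Matrix (Fin N) (Fin N) ℂ) :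
    hsq N (R - Sᴴ) = hsq N R + hsq N S - 2 * (ntr N (R * S)).re := by
  have h := hsq_eq N (R - Sᴴ)
  have e : (R - Sᴴ) * (R - Sᴴ)ᴴ = R * Rᴴ - R * S - (R * S)ᴴ + Sᴴ * S := by
    simp [sub_mul, mul_sub]; abel
  rw [e, ntr_add, ntr_sub, ntr_sub, ntr_conjT, hsq_eq, ntr_comm N Sᴴ S, hsq_eq] at h
  have := congrArg Complex.re h
  simp at this
  linarith

lemma imP_re (N : ℕ) (R : Matrix (Fin N) (Fin N) ℂ) : (ntr N (imP N R)).re = (ntr N R).im := by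
  unfold imP
  rw [ntr_smul, ntr_sub, ntr_conjT]
  have : ntr N R - star (ntr N R) = 2 * Complex.I * ((ntr N R).im : ℂ) := by
    apply Complex.ext <;> simp; ring
  rw [this, inv_mul_cancel_left₀]
  · simp
  · simp

lemma im_pos_of_posDef (N : ℕ) (hN : 1 ≤ N) (R : Matrix (Fin N) (Fin N) ℂ)
    (h : (imP N R).PosDef) : 0 < (ntr N R).im := by
  rw [← imP_re]
  haveI : Nonempty (Fin N) := ⟨⟨0, hN⟩⟩
  have h2 := h.trace_pos
  have h3 := (Complex.lt_def.1 h2).1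
  unfold ntr
  have : ((N : ℂ)⁻¹) = (((N : ℝ)⁻¹ : ℝ) : ℂ) := by simp
  rw [this, Complex.re_ofReal_mul]
  simp at h3 
  positivity

section sol
variable {N : ℕ} {B A : Matrix (Fin N) (Fin N) ℂ} {Msol : ℝ → ℂ → Matrix (Fin N) (Fin N) ℂ}

lemma sol_im_pos (hN : 1 ≤ N) (h : IsMDESol N B A Msol) (x : ℝ) (z : ℂ) (hz : 0 < z.im) :
    0 < (ntr N (Msol x z)).im := im_pos_of_posDef N hN _ (h x z hz).2

lemma sol_inv (h : IsMDESol N B A Msol) (x : ℝ) (z : ℂ) (hz : 0 < z.im) :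
    (Msol x z)⁻¹ = B + x • A - (z + ntr N (Msol x z)) • (1 : Matrix (Fin N) (Fin N) ℂ) := by
  have := (h x z hz).1
  rw [← neg_neg (Msol x z)⁻¹, this, add_smul]; abel

lemma sol_unit (hN : 1 ≤ N) (hB : B.IsHermitian) (hA : A.IsHermitian)
    (h : IsMDESol N B A Msol) (x : ℝ) (z : ℂ) (hz : 0 < z.im) : IsUnit (Msol x z).det := by
  by_contra hc
  have h1 := sol_inv h x z hz
  rw [Matrix.nonsing_inv_apply_not_isUnit _ hc] at h1
  have h2 := sol_im_pos hN h x z hz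
  have h3 := congrArg (fun R : Matrix (Fin N) (Fin N) ℂ => (R ⟨0, hN⟩ ⟨0, hN⟩).im) h1
  have b := hB.coe_re_apply_self ⟨0, hN⟩
  have a := hA.coe_re_apply_self ⟨0, hN⟩
  have b' := congrArg Complex.im b
  have a' := congrArg Complex.im a
  simp at h3 a' b'
  rw [← a', ← b'] at h3
  simp at h3
  linarith

lemma sol_diff (hN : 1 ≤ N) (hB : B.IsHermitian) (hA : A.IsHermitian)
    (h : IsMDESol N B A Msol) (x y : ℝ) (z w : ℂ) (hz : 0 < z.im) (hw : 0 < w.im) :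
    Msol y w - Msol x z = (x - y) • (Msol x z * A * Msol y w)
      - (z - w + (ntr N (Msol x z) - ntr N (Msol y w))) • (Msol x z * Msol y w) := by
  have u1 := sol_unit hN hB hA h x z hz
  have u2 := sol_unit hN hB hA h y w hw
  have e : Msol y w - Msol x z = Msol x z * ((Msol x z)⁻¹ - (Msol y w)⁻¹) * Msol y w := by
    rw [mul_sub, sub_mul, Matrix.mul_nonsing_inv _ u1, mul_assoc, Matrix.nonsing_inv_mul _ u2]
    simp
  have e2 : (Msol x z)⁻¹ - (Msol y w)⁻¹ = (x - y) • A
      - (z - w + (ntr N (Msol x z) - ntr N (Msol y w))) • (1 : Matrix (Fin N) (Fin N) ℂ) := by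
    rw [sol_inv h x z hz, sol_inv h y w hw]
    simp only [add_smul, sub_smul]; abel
  rw [e2] at e
  rw [e]
  simp [mul_sub, sub_mul]

lemma sol_ward (hN : 1 ≤ N) (hB : B.IsHermitian) (hA : A.IsHermitian)
    (h : IsMDESol N B A Msol) (x : ℝ) (z : ℂ) (hz : 0 < z.im) : hsq N (Msol x z) ≤ 1 := by
  set M := Msol x z with hM
  have u1 := sol_unit hN hB hA h x z hz
  have v := sol_im_pos hN h x z hz
  rw [← hM] at u1 v
  have u2 : IsUnit (Mᴴ).det := by
    rw [Matrix.det_conjTranspose]; exact u1.star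
  have i1 := sol_inv h x z hz
  rw [← hM] at i1
  have i2 : (Mᴴ)⁻¹ = B + x • A - star (z + ntr N M) • (1 : Matrix (Fin N) (Fin N) ℂ) := by
    rw [← Matrix.conjTranspose_nonsing_inv, i1]
    simp [hB.eq, hA.eq]
  have e : M - Mᴴ = M * ((Mᴴ)⁻¹ - M⁻¹) * Mᴴ := by
    rw [mul_sub, sub_mul, Matrix.mul_nonsing_inv _ u1, mul_assoc, Matrix.nonsing_inv_mul _ u2]
    simp
  have e2 : (Mᴴ)⁻¹ - M⁻¹ = ((z + ntr N M) - star (z + ntr N M)) • (1 : Matrix (Fin N) (Fin N) ℂ) := by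
    rw [i1, i2, sub_smul]; abel
  rw [e2] at e
  have e3 := congrArg (ntr N) e
  rw [ntr_sub, ntr_conjT, mul_smul_comm, mul_one, smul_mul_assoc, ntr_smul, hsq_eq] at e3
  have e4 := congrArg Complex.im e3
  simp at e4
  nlinarith [hsq_nonneg N M]

lemma sol_stab (hN : 1 ≤ N) (hB : B.IsHermitian) (hA : A.IsHermitian)
    (h : IsMDESol N B A Msol) (x y : ℝ) (z w : ℂ) (hz : 0 < z.im) (hw : 0 < w.im) :
    ((ntr N (Msol x z)).im + (ntr N (Msol y w)).im) ^ 2 / 2 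
      ≤ ‖1 - ntr N (Msol x z * Msol y w)‖ := by
  have h1 := sol_ward hN hB hA h x z hz
  have h2 := sol_ward hN hB hA h y w hw
  have h3 := hsq_sub_conjT N (Msol x z) (Msol y w)
  have h4 := ntr_sq_le N hN (Msol x z - (Msol y w)ᴴ)
  rw [ntr_sub, ntr_conjT] at h4
  have h5 := Complex.abs_im_le_norm (ntr N (Msol x z) - star (ntr N (Msol y w)))
  have h6 := Complex.re_le_norm (1 - ntr N (Msol x z * Msol y w))
  simp at h5 h6
  have h7 := pow_le_pow_left₀ (abs_nonneg _) h5 2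
  rw [sq_abs] at h7
  simp at h4
  linarith

lemma sol_mdiff (hN : 1 ≤ N) (hB : B.IsHermitian) (hA : A.IsHermitian)
    (h : IsMDESol N B A Msol) (x y : ℝ) (z w : ℂ) (hz : 0 < z.im) (hw : 0 < w.im) :
    (ntr N (Msol y w) - ntr N (Msol x z)) * (1 - ntr N (Msol x z * Msol y w)) 
      = (w - z) * ntr N (Msol x z * Msol y w) - ((y - x : ℝ) : ℂ) * ntr N (Msol x z * A * Msol y w) := by
  have := congrArg (ntr N) (sol_diff hN hB hA h x y z w hz hw)
  rw [ntr_sub, ntr_sub, ntr_smul, ntr_rsmul] at this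
  push_cast at this ⊢
  linear_combination this

lemma sol_ntr_mul_le (hN : 1 ≤ N) (hB : B.IsHermitian) (hA : A.IsHermitian)
    (h : IsMDESol N B A Msol) (x y : ℝ) (z w : ℂ) (hz : 0 < z.im) (hw : 0 < w.im) :
    ‖ntr N (Msol x z * Msol y w)‖ ≤ 1 := by
  have h1 := sol_ward hN hB hA h x z hz
  have h2 := sol_ward hN hB hA h y w hw
  have h3 := ntr_mul_sq_le N (Msol x z) (Msol y w)
  have := hsq_nonneg N (Msol x z) 
  have := hsq_nonneg N (Msol y w)
  have h4 : hsq N (Msol x z) * hsq N (Msol y w) ≤ 1 := by nlinarith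
  nlinarith [norm_nonneg (ntr N (Msol x z * Msol y w))]

lemma sol_holder (hN : 1 ≤ N) (hB : B.IsHermitian) (hA : A.IsHermitian)
    (h : IsMDESol N B A Msol) (x : ℝ) (z w : ℂ) (hz : 0 < z.im) (hw : 0 < w.im) :
    |(ntr N (Msol x w)).im - (ntr N (Msol x z)).im| * 
      ((ntr N (Msol x z)).im + (ntr N (Msol x w)).im) ^ 2 ≤ 2 * ‖w - z‖ := by
  have h1 := sol_mdiff hN hB hA h x x z w hz hw
  have h2 := sol_stab hN hB hA h x x z w hz hw
  have h3 := sol_ntr_mul_le hN hB hA h x x z w hz hw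
  have h4 := congrArg norm h1
  have h5 := Complex.abs_im_le_norm (ntr N (Msol x w) - ntr N (Msol x z))
  simp only [sub_self, Complex.ofReal_zero, zero_mul, sub_zero, norm_mul, Complex.sub_im] at h4 h5
  have h6 : |(ntr N (Msol x w)).im - (ntr N (Msol x z)).im| *
     (((ntr N (Msol x z)).im + (ntr N (Msol x w)).im) ^ 2 / 2) ≤ ‖w - z‖ := by
    calc _ ≤ _ := mul_le_mul h5 h2 (by positivity) (norm_nonneg _)
      _ = _ := h4
      _ ≤ _ := mul_le_of_le_one_right (norm_nonneg _) h3
  linarith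

lemma continuous_ntr (N : ℕ) : Continuous (ntr N) := by
  unfold ntr; fun_prop

lemma sol_stab_ne (hN : 1 ≤ N) (hB : B.IsHermitian) (hA : A.IsHermitian)
    (h : IsMDESol N B A Msol) (x y : ℝ) (z w : ℂ) (hz : 0 < z.im) (hw : 0 < w.im) :
    1 - ntr N (Msol x z * Msol y w) ≠ 0 := by
  have h1 := sol_stab hN hB hA h x y z w hz hw
  have h2 := sol_im_pos hN h x z hz
  have h3 := sol_im_pos hN h y w hw
  rw [← norm_pos_iff]
  refine lt_of_lt_of_le ?_ h1
  positivity

lemma sol_m_cont (hN : 1 ≤ N) (hB : B.IsHermitian) (hA : A.IsHermitian)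
    (h : IsMDESol N B A Msol) (p : ℝ × ℂ) (hp : 0 < p.2.im) :
    ContinuousAt (fun q : ℝ × ℂ => ntr N (Msol q.1 q.2)) p := by
  set v := (ntr N (Msol p.1 p.2)).im with hv
  have v0 : 0 < v := sol_im_pos hN h p.1 p.2 hp
  set K := Real.sqrt (hsq N (Msol p.1 p.2 * A)) with hK
  have key : ∀ᶠ q : ℝ × ℂ in nhds p, ‖ntr N (Msol q.1 q.2) - ntr N (Msol p.1 p.2)‖ ≤
      (‖q.2 - p.2‖ + |q.1 - p.1| * K) / (v ^ 2 / 2) := by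
    have ho : ∀ᶠ q : ℝ × ℂ in nhds p, 0 < q.2.im := by
      have : Continuous (fun q : ℝ × ℂ => q.2.im) := by fun_prop
      exact this.continuousAt.eventually (lt_mem_nhds hp)
    filter_upwards [ho] with q hq
    rw [le_div_iff₀ (by positivity)]
    have h1 := sol_mdiff hN hB hA h p.1 q.1 p.2 q.2 hp hq
    have h2 := sol_stab hN hB hA h p.1 q.1 p.2 q.2 hp hq
    have h3 := sol_ntr_mul_le hN hB hA h p.1 q.1 p.2 q.2 hp hq
    have h3' := sol_im_pos hN h q.1 q.2 hq
    have h4 : ‖ntr N (Msol p.1 p.2 * A * Msol q.1 q.2)‖ ≤ K := by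
      apply Real.le_sqrt_of_sq_le
      refine (ntr_mul_sq_le N _ _).trans ?_
      exact mul_le_of_le_one_right (hsq_nonneg _ _) (sol_ward hN hB hA h q.1 q.2 hq)
    have h5 := congrArg norm h1
    rw [norm_mul] at h5
    have h6 : v ^ 2 / 2 ≤ ‖1 - ntr N (Msol p.1 p.2 * Msol q.1 q.2)‖ := by
      refine le_trans ?_ h2
      rw [← hv]; gcongr; linarith
    calc _ ≤ _ := mul_le_mul_of_nonneg_left h6 (norm_nonneg _)
      _ = _ := h5
      _ ≤ _ := norm_sub_le _ _
      _ ≤ _ := by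
        rw [norm_mul, norm_mul, Complex.norm_real, Real.norm_eq_abs]
        exact add_le_add (mul_le_of_le_one_right (norm_nonneg _) h3)
          (mul_le_mul_of_nonneg_left h4 (abs_nonneg _))
  rw [ContinuousAt, tendsto_iff_norm_sub_tendsto_zero]
  refine squeeze_zero' (Eventually.of_forall fun _ => norm_nonneg _) key ?_
  have c : Continuous (fun q : ℝ × ℂ => (‖q.2 - p.2‖ + |q.1 - p.1| * K) / (v ^ 2 / 2)) := by
    fun_prop
  have := c.tendsto p
  simpa using this

lemma sol_cont (hN : 1 ≤ N) (hB : B.IsHermitian) (hA : A.IsHermitian)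
    (h : IsMDESol N B A Msol) (p : ℝ × ℂ) (hp : 0 < p.2.im) :
    ContinuousAt (fun q : ℝ × ℂ => Msol q.1 q.2) p := by
  have hm := sol_m_cont hN hB hA h p hp
  set X : ℝ × ℂ → Matrix (Fin N) (Fin N) ℂ := fun q =>
    B + q.1 • A - (q.2 + ntr N (Msol q.1 q.2)) • (1 : Matrix (Fin N) (Fin N) ℂ) with hX
  have cX : ContinuousAt X p := by
    have h1 : ContinuousAt (fun q : ℝ × ℂ => q.2 + ntr N (Msol q.1 q.2)) p :=
      continuous_snd.continuousAt.add hm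
    have h2 : ContinuousAt (fun q : ℝ × ℂ => B + q.1 • A) p := by
      have : Continuous (fun q : ℝ × ℂ => B + q.1 • A) := by fun_prop
      exact this.continuousAt
    exact h2.sub (h1.smul continuousAt_const)
  have ho : ∀ᶠ q : ℝ × ℂ in nhds p, 0 < q.2.im := by
    have : Continuous (fun q : ℝ × ℂ => q.2.im) := by fun_prop
    exact this.continuousAt.eventually (lt_mem_nhds hp)
  have hinv : ∀ q : ℝ × ℂ, 0 < q.2.im → Msol q.1 q.2 = (X q).det⁻¹ • (X q).adjugate := by
    intro q hq
    rw [← Ring.inverse_eq_inv', ← Matrix.inv_def, hX]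
    simp only
    rw [← sol_inv h q.1 q.2 hq, Matrix.nonsing_inv_nonsing_inv _ (sol_unit hN hB hA h q.1 q.2 hq)]
  have hd : (X p).det ≠ 0 := by
    have u := sol_unit hN hB hA h p.1 p.2 hp
    have : X p = (Msol p.1 p.2)⁻¹ := (sol_inv h p.1 p.2 hp).symm
    rw [this]
    exact (Matrix.isUnit_nonsing_inv_det _ u).ne_zero
  have c1 : ContinuousAt (fun q => (X q).det) p :=
    (Continuous.matrix_det continuous_id).continuousAt.comp cX
  have c2 : ContinuousAt (fun q => (X q).adjugate) p :=
    (Continuous.matrix_adjugate continuous_id).continuousAt.comp cX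
  have c3 : ContinuousAt (fun q => (X q).det⁻¹ • (X q).adjugate) p := (c1.inv₀ hd).smul c2
  refine c3.congr ?_
  filter_upwards [ho] with q hq
  exact (hinv q hq).symm

lemma sol_cont2 (hN : 1 ≤ N) (hB : B.IsHermitian) (hA : A.IsHermitian)
    (h : IsMDESol N B A Msol) (η : ℝ) (hη : 0 < η) :
    Continuous (fun q : ℝ × ℝ => Msol q.1 (q.2 + η * Complex.I)) := by
  rw [continuous_iff_continuousAt]
  intro q
  have c : Continuous (fun q : ℝ × ℝ => ((q.1, (q.2 : ℂ) + η * Complex.I) : ℝ × ℂ)) := by fun_prop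
  exact (sol_cont hN hB hA h (q.1, (q.2 : ℂ) + η * Complex.I) (by simpa using hη)).comp
    (f := fun q : ℝ × ℝ => ((q.1, (q.2 : ℂ) + η * Complex.I) : ℝ × ℂ)) c.continuousAt

def Dfun (N : ℕ) (A : Matrix (Fin N) (Fin N) ℂ) (M : Matrix (Fin N) (Fin N) ℂ) : ℂ :=
  ntr N (M * A * M) / (1 - ntr N (M * M))

lemma sol_deriv_x (hN : 1 ≤ N) (hB : B.IsHermitian) (hA : A.IsHermitian)
    (h : IsMDESol N B A Msol) (η : ℝ) (hη : 0 < η) (t x : ℝ) :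
    HasDerivAt (fun x : ℝ => ntr N (Msol x (t + η * Complex.I)))
      (- Dfun N A (Msol x (t + η * Complex.I))) x := by
  have hz : 0 < ((t : ℂ) + η * Complex.I).im := by simpa using hη
  rw [hasDerivAt_iff_tendsto_slope]
  have c0 := sol_cont2 hN hB hA h η hη
  have c1 : Continuous (fun y : ℝ => Msol y (t + η * Complex.I)) :=
    c0.comp (f := fun y : ℝ => (y, t)) (by fun_prop)
  have c2 : ContinuousAt (fun y : ℝ =>
      - (ntr N (Msol x (t + η * Complex.I) * A * Msol y (t + η * Complex.I)) /
        (1 - ntr N (Msol x (t + η * Complex.I) * Msol y (t + η * Complex.I))))) x := by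
    apply ContinuousAt.neg
    apply ContinuousAt.div
    · exact ((continuous_ntr N).comp (continuous_const.mul c1)).continuousAt
    · exact (continuous_const.sub ((continuous_ntr N).comp (continuous_const.mul c1))).continuousAt
    · exact sol_stab_ne hN hB hA h x x _ _ hz hz
  refine Tendsto.congr' ?_ (c2.tendsto.mono_left nhdsWithin_le_nhds)
  filter_upwards [self_mem_nhdsWithin] with y hy
  have h1 := sol_mdiff hN hB hA h x y _ _ hz hz
  have h2 := sol_stab_ne hN hB hA h x y _ _ hz hz
  have h3 : ((y - x : ℝ) : ℂ) ≠ 0 := by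
    exact_mod_cast sub_ne_zero.2 hy
  rw [slope_def_module, Complex.real_smul, Complex.ofReal_inv]
  rw [eq_comm, inv_mul_eq_iff_eq_mul₀ h3, eq_comm]
  rw [mul_neg, ← mul_div_assoc, neg_eq_iff_eq_neg, div_eq_iff h2]
  linear_combination h1

lemma sol_deriv_t (hN : 1 ≤ N) (hB : B.IsHermitian) (hA : A.IsHermitian)
    (h : IsMDESol N B A Msol) (η : ℝ) (hη : 0 < η) (x t : ℝ) :
    HasDerivAt (fun t : ℝ => ntr N (Msol x (t + η * Complex.I) * A))
      (Dfun N A (Msol x (t + η * Complex.I))) t := by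
  have hz : ∀ t : ℝ, 0 < ((t : ℂ) + η * Complex.I).im := by intro t; simpa using hη
  rw [hasDerivAt_iff_tendsto_slope]
  have c0 := sol_cont2 hN hB hA h η hη
  have c1 : Continuous (fun s : ℝ => Msol x (s + η * Complex.I)) :=
    c0.comp (f := fun s : ℝ => (x, s)) (by fun_prop)
  have c2 : ContinuousAt (fun s : ℝ =>
      (ntr N (Msol x (t + η * Complex.I) * Msol x (s + η * Complex.I) * A) /
        (1 - ntr N (Msol x (t + η * Complex.I) * Msol x (s + η * Complex.I))))) t := by
    apply ContinuousAt.div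
    · exact ((continuous_ntr N).comp ((continuous_const.mul c1).mul continuous_const)).continuousAt
    · exact (continuous_const.sub ((continuous_ntr N).comp (continuous_const.mul c1))).continuousAt
    · exact sol_stab_ne hN hB hA h x x _ _ (hz t) (hz t)
  have e0 : Dfun N A (Msol x (t + η * Complex.I)) =
      (ntr N (Msol x (t + η * Complex.I) * Msol x (t + η * Complex.I) * A) /
        (1 - ntr N (Msol x (t + η * Complex.I) * Msol x (t + η * Complex.I)))) := by
    unfold Dfun
    rw [mul_assoc, ntr_comm, ntr_comm N _ A, mul_assoc, ntr_comm N A]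
  rw [e0]
  refine Tendsto.congr' ?_ (c2.tendsto.mono_left nhdsWithin_le_nhds)
  filter_upwards [self_mem_nhdsWithin] with s hs
  have h1 := sol_mdiff hN hB hA h x x _ _ (hz t) (hz s)
  have h2 := sol_stab_ne hN hB hA h x x _ _ (hz t) (hz s)
  have h3 : ((s - t : ℝ) : ℂ) ≠ 0 := by
    exact_mod_cast sub_ne_zero.2 hs
  have h4 := congrArg (fun R => ntr N (R * A)) (sol_diff hN hB hA h x x _ _ (hz t) (hz s))
  simp only [sub_self, zero_smul, zero_sub, ← neg_smul, smul_mul_assoc, ntr_smul, sub_mul, ntr_sub] at h4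
  simp only [sub_self, Complex.ofReal_zero, zero_mul, sub_zero] at h1
  rw [slope_def_module, Complex.real_smul, Complex.ofReal_inv]
  rw [eq_comm, inv_mul_eq_iff_eq_mul₀ h3, ← mul_div_assoc, eq_div_iff h2, h4]
  push_cast at h1 ⊢
  linear_combination (ntr N (Msol x (t + η * Complex.I) * Msol x (s + η * Complex.I) * A)) * h1

lemma sol_g_le (hN : 1 ≤ N) (hB : B.IsHermitian) (hA : A.IsHermitian)
    (h : IsMDESol N B A Msol) (x : ℝ) (z : ℂ) (hz : 0 < z.im) :
    ‖ntr N (Msol x z * A)‖ ≤ Real.sqrt (hsq N A) := by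
  apply Real.le_sqrt_of_sq_le
  refine (ntr_mul_sq_le N _ _).trans ?_
  exact mul_le_of_le_one_left (hsq_nonneg _ _) (sol_ward hN hB hA h x z hz)

lemma sol_int (hN : 1 ≤ N) (hB : B.IsHermitian) (hA : A.IsHermitian)
    (h : IsMDESol N B A Msol) (η : ℝ) (hη : 0 < η) (x₁ x₂ L E : ℝ) :
    |(∫ t in L..E, (ntr N (Msol x₂ (t + η * Complex.I))).im) -
      ∫ t in L..E, (ntr N (Msol x₁ (t + η * Complex.I))).im|
      ≤ 2 * Real.sqrt (hsq N A) * |x₂ - x₁| := by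
  have hz : ∀ t : ℝ, 0 < ((t : ℂ) + η * Complex.I).im := by intro t; simpa using hη
  have c0 := sol_cont2 hN hB hA h η hη
  have cx : ∀ t : ℝ, Continuous (fun y : ℝ => Msol y (t + η * Complex.I)) := fun t =>
    c0.comp (f := fun y : ℝ => (y, t)) (by fun_prop)
  have ct : ∀ x : ℝ, Continuous (fun s : ℝ => Msol x (s + η * Complex.I)) := fun x =>
    c0.comp (f := fun s : ℝ => (x, s)) (by fun_prop)
  have cD : Continuous (fun q : ℝ × ℝ => Dfun N A (Msol q.1 (q.2 + η * Complex.I))) := by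
    unfold Dfun
    apply Continuous.div
    · exact (continuous_ntr N).comp ((c0.mul continuous_const).mul c0)
    · exact continuous_const.sub ((continuous_ntr N).comp (c0.mul c0))
    · intro q; exact sol_stab_ne hN hB hA h _ _ _ _ (hz _) (hz _)
  have cDx : ∀ t : ℝ, Continuous (fun y : ℝ => Dfun N A (Msol y (t + η * Complex.I))) := fun t =>
    cD.comp (f := fun y : ℝ => (y, t)) (by fun_prop)
  have cDt : ∀ x : ℝ, Continuous (fun s : ℝ => Dfun N A (Msol x (s + η * Complex.I))) := fun x =>
    cD.comp (f := fun s : ℝ => (x, s)) (by fun_prop)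
  have cm : ∀ x : ℝ, Continuous (fun s : ℝ => ntr N (Msol x (s + η * Complex.I))) := fun x =>
    (continuous_ntr N).comp (ct x)
  have s1 : ∀ t : ℝ, ntr N (Msol x₂ (t + η * Complex.I)) - ntr N (Msol x₁ (t + η * Complex.I)) =
      ∫ x in x₁..x₂, - Dfun N A (Msol x (t + η * Complex.I)) := fun t =>
    (intervalIntegral.integral_eq_sub_of_hasDerivAt
      (fun x _ => sol_deriv_x hN hB hA h η hη t x) ((cDx t).neg.intervalIntegrable _ _)).symm
  have s2 : ∀ x : ℝ, ∫ t in L..E, - Dfun N A (Msol x (t + η * Complex.I)) =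
      -(ntr N (Msol x (E + η * Complex.I) * A) - ntr N (Msol x (L + η * Complex.I) * A)) := by
    intro x
    rw [intervalIntegral.integral_neg, intervalIntegral.integral_eq_sub_of_hasDerivAt
      (fun t _ => sol_deriv_t hN hB hA h η hη x t) ((cDt x).intervalIntegrable _ _)]
  have s3 : (∫ t in L..E, (ntr N (Msol x₂ (t + η * Complex.I)) -
      ntr N (Msol x₁ (t + η * Complex.I)))) = ∫ x in x₁..x₂,
      -(ntr N (Msol x (E + η * Complex.I) * A) - ntr N (Msol x (L + η * Complex.I) * A)) := by
    simp_rw [s1, ← s2]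
    apply MeasureTheory.intervalIntegral_intervalIntegral_swap
    have : Continuous (Function.uncurry fun t x : ℝ => - Dfun N A (Msol x (t + η * Complex.I))) :=
      (cD.comp continuous_swap).neg
    refine IntegrableOn.mono_set (t := Set.uIcc L E ×ˢ Set.uIcc x₁ x₂) ?_
      (Set.prod_mono Set.uIoc_subset_uIcc Set.uIoc_subset_uIcc)
    exact this.continuousOn.integrableOn_compact (isCompact_uIcc.prod isCompact_uIcc)
  have s4 : ‖∫ t in L..E, (ntr N (Msol x₂ (t + η * Complex.I)) -
      ntr N (Msol x₁ (t + η * Complex.I)))‖ ≤ 2 * Real.sqrt (hsq N A) * |x₂ - x₁| := by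
    rw [s3]
    apply intervalIntegral.norm_integral_le_of_norm_le_const
    intro x _
    rw [norm_neg]
    refine (norm_sub_le _ _).trans ?_
    linarith [sol_g_le hN hB hA h x _ (hz E), sol_g_le hN hB hA h x _ (hz L)]
  have s5 : (∫ t in L..E, (ntr N (Msol x₂ (t + η * Complex.I))).im) -
      ∫ t in L..E, (ntr N (Msol x₁ (t + η * Complex.I))).im = (∫ t in L..E, (ntr N (Msol x₂ (t + η * Complex.I)) -
      ntr N (Msol x₁ (t + η * Complex.I)))).im := by
    have i : ∀ x : ℝ, IntervalIntegrable (fun t : ℝ => (ntr N (Msol x (t + η * Complex.I))).im)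
        volume L E := fun x => (Complex.continuous_im.comp (cm x)).intervalIntegrable _ _
    rw [← intervalIntegral.integral_sub (i x₂) (i x₁)]
    have := Complex.imCLM.intervalIntegral_comp_comm
      (((cm x₂).sub (cm x₁)).intervalIntegrable (μ := volume) L E)
    simpa using this
  rw [s5]
  exact (Complex.abs_im_le_norm _).trans s4

section dos
variable {ρ : ℝ → ℝ → ℝ}

lemma dos_tendsto (hρ : IsSCDos N Msol ρ) (x E : ℝ) :
    Tendsto (fun η : ℝ => (ntr N (Msol x (E + η * Complex.I))).im)
      (nhdsWithin 0 (Set.Ioi 0)) (nhds (Real.pi * ρ x E)) := by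
  have := (hρ x E).const_mul Real.pi
  simp only [imP_re] at this
  refine this.congr fun η => ?_
  rw [mul_inv_cancel_left₀ Real.pi_ne_zero]

lemma dos_nonneg (hN : 1 ≤ N) (h : IsMDESol N B A Msol) (hρ : IsSCDos N Msol ρ) (x E : ℝ) :
    0 ≤ ρ x E := by
  have := dos_tendsto hρ x E
  have h2 : 0 ≤ Real.pi * ρ x E := by
    refine ge_of_tendsto this ?_
    filter_upwards [self_mem_nhdsWithin] with η hη
    exact (sol_im_pos hN h x _ (by simpa using hη)).le
  exact nonneg_of_mul_nonneg_right h2 Real.pi_pos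

lemma dos_holder (hN : 1 ≤ N) (hB : B.IsHermitian) (hA : A.IsHermitian)
    (h : IsMDESol N B A Msol) (hρ : IsSCDos N Msol ρ) (x E G : ℝ) :
    |Real.pi * ρ x G - Real.pi * ρ x E| * (Real.pi * ρ x E + Real.pi * ρ x G) ^ 2 
      ≤ 2 * |G - E| := by
  have h1 := dos_tendsto hρ x E
  have h2 := dos_tendsto hρ x G
  refine le_of_tendsto ((h2.sub h1).abs.mul ((h1.add h2).pow 2)) ?_
  filter_upwards [self_mem_nhdsWithin] with η hη
  have h3 := sol_holder hN hB hA h x (E + η * Complex.I) (G + η * Complex.I) (by simpa using hη)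
    (by simpa using hη)
  refine h3.trans (le_of_eq ?_)
  rw [add_sub_add_right_eq_sub, ← Complex.ofReal_sub, Complex.norm_real, Real.norm_eq_abs]

lemma dos_cont (hN : 1 ≤ N) (hB : B.IsHermitian) (hA : A.IsHermitian)
    (h : IsMDESol N B A Msol) (hρ : IsSCDos N Msol ρ) (x : ℝ) : Continuous (ρ x) := by
  rw [continuous_iff_continuousAt]
  intro E
  have key : ∀ G, |ρ x G - ρ x E| ^ 3 ≤ 2 * |G - E| := by
    intro G
    have h1 := dos_holder hN hB hA h hρ x E G
    have h2 := dos_nonneg hN h hρ x E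
    have h3 := dos_nonneg hN h hρ x G
    rw [← mul_sub, ← mul_add, abs_mul, abs_of_pos Real.pi_pos] at h1
    have h4 : |ρ x G - ρ x E| ≤ ρ x E + ρ x G := by
      rw [abs_le]; constructor <;> linarith
    have h5 : (1:ℝ) ≤ Real.pi := by linarith [Real.pi_gt_three]
    have h6 : |ρ x G - ρ x E| ≤ Real.pi * |ρ x G - ρ x E| :=
      le_mul_of_one_le_left (abs_nonneg _) h5
    have h7 : |ρ x G - ρ x E| ≤ Real.pi * (ρ x E + ρ x G) :=
      h4.trans (le_mul_of_one_le_left (by linarith) h5)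
    calc |ρ x G - ρ x E| ^ 3 = |ρ x G - ρ x E| * |ρ x G - ρ x E| ^ 2 := by ring
      _ ≤ (Real.pi * |ρ x G - ρ x E|) * (Real.pi * (ρ x E + ρ x G)) ^ 2 := by gcongr
      _ ≤ _ := h1
  rw [Metric.continuousAt_iff]
  intro e he
  refine ⟨e ^ 3 / 2, by positivity, fun {G} hG => ?_⟩
  rw [Real.dist_eq] at hG ⊢
  refine lt_of_pow_lt_pow_left₀ 3 he.le ?_
  linarith [key G]

lemma dos_int (hN : 1 ≤ N) (hB : B.IsHermitian) (hA : A.IsHermitian)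
    (h : IsMDESol N B A Msol) (hρ : IsSCDos N Msol ρ) (x₁ x₂ L E : ℝ) :
    |(∫ t in L..E, ρ x₂ t) - ∫ t in L..E, ρ x₁ t| ≤ 
      2 * Real.sqrt (hsq N A) * |x₂ - x₁| / Real.pi := by
  have lim : ∀ x : ℝ, Tendsto (fun η : ℝ => ∫ t in L..E, (ntr N (Msol x (t + η * Complex.I))).im)
      (nhdsWithin 0 (Set.Ioi 0)) (nhds (∫ t in L..E, Real.pi * ρ x t)) := by
    intro x
    apply intervalIntegral.tendsto_integral_filter_of_dominated_convergence (fun _ => (1:ℝ))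
    · filter_upwards [self_mem_nhdsWithin] with η hη
      have c0 := sol_cont2 hN hB hA h η hη
      have ct : Continuous (fun s : ℝ => Msol x (s + η * Complex.I)) :=
        c0.comp (f := fun s : ℝ => (x, s)) (by fun_prop)
      exact (Complex.continuous_im.comp ((continuous_ntr N).comp ct)).aestronglyMeasurable
    · filter_upwards [self_mem_nhdsWithin] with η hη
      refine Eventually.of_forall fun t _ => ?_
      have h1 := sol_ward hN hB hA h x (t + η * Complex.I) (by simpa using hη)
      have h2 := ntr_sq_le N hN (Msol x (t + η * Complex.I))
      refine (Complex.abs_im_le_norm _).trans ?_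
      nlinarith [norm_nonneg (ntr N (Msol x (t + η * Complex.I)))]
    · simp
    · exact Eventually.of_forall fun t _ => dos_tendsto hρ x t
  have h1 : |(∫ t in L..E, Real.pi * ρ x₂ t) - ∫ t in L..E, Real.pi * ρ x₁ t| ≤ 
      2 * Real.sqrt (hsq N A) * |x₂ - x₁| := by
    refine le_of_tendsto ((lim x₂).sub (lim x₁)).abs ?_
    filter_upwards [self_mem_nhdsWithin] with η hη
    exact sol_int hN hB hA h η hη x₁ x₂ L E
  rw [intervalIntegral.integral_const_mul, intervalIntegral.integral_const_mul, ← mul_sub,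
    abs_mul, abs_of_pos Real.pi_pos] at h1
  rw [le_div_iff₀ Real.pi_pos]
  linarith

lemma dos_int' (hN : 1 ≤ N) (hB : B.IsHermitian) (hA : A.IsHermitian)
    (h : IsMDESol N B A Msol) (hρ : IsSCDos N Msol ρ) (x₁ x₂ E : ℝ)
    (i1 : IntegrableOn (ρ x₁) (Set.Iic E)) (i2 : IntegrableOn (ρ x₂) (Set.Iic E)) :
    |(∫ t in Set.Iic E, ρ x₂ t) - ∫ t in Set.Iic E, ρ x₁ t| ≤ 
      2 * Real.sqrt (hsq N A) * |x₂ - x₁| / Real.pi := by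
  have l1 := intervalIntegral_tendsto_integral_Iic E i1 tendsto_id
  have l2 := intervalIntegral_tendsto_integral_Iic E i2 tendsto_id
  exact le_of_tendsto (l2.sub l1).abs (Eventually.of_forall fun L => dos_int hN hB hA h hρ x₁ x₂ L E)

lemma core (hN : 1 ≤ N) (hB : B.IsHermitian) (hA : A.IsHermitian)
    (h : IsMDESol N B A Msol) (hρ : IsSCDos N Msol ρ) (c₁ : ℝ) (hc : 0 < c₁) (x₁ x₂ g₁ g₂ q : ℝ)
    (hq : 0 < q)
    (hg1 : ∫ t in Set.Iic g₁, ρ x₁ t = q) (hg2 : ∫ t in Set.Iic g₂, ρ x₂ t = q)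
    (hb : c₁ ≤ ρ x₂ g₂)
    (hs : |x₂ - x₁| * Real.sqrt (hsq N A) ≤ c₁ * ((Real.pi * c₁) ^ 3 / 4) / 4) :
    |g₁ - g₂| ≤ 4 / (Real.pi * c₁) * (|x₂ - x₁| * Real.sqrt (hsq N A)) := by
  have pi := Real.pi_gt_three
  have cont := dos_cont hN hB hA h hρ
  have hint : ∀ x g : ℝ, ∫ t in Set.Iic g, ρ x t = q → ∀ E, IntegrableOn (ρ x) (Set.Iic E) := by
    intro x g hg E
    have h1 : IntegrableOn (ρ x) (Set.Iic g) := by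
      by_contra hc
      rw [integral_undef hc] at hg
      linarith
    refine IntegrableOn.mono_set (h1.union ((cont x).integrableOn_Icc (a := g) (b := E))) ?_
    intro t ht
    by_cases htg : t ≤ g
    · exact Or.inl htg
    · exact Or.inr ⟨(not_le.1 htg).le, ht⟩
  have i1 := hint x₁ g₁ hg1
  have i2 := hint x₂ g₂ hg2
  have h1 := dos_int' hN hB hA h hρ x₁ x₂ g₁ (i1 g₁) (i2 g₁)
  rw [hg1, ← hg2, intervalIntegral.integral_Iic_sub_Iic (i2 g₂) (i2 g₁)] at h1
  set ε := |x₂ - x₁| * Real.sqrt (hsq N A) with hε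
  have h1' : |∫ t in g₂..g₁, ρ x₂ t| ≤ 2 * ε / Real.pi := by
    refine h1.trans (le_of_eq ?_); rw [hε]; ring
  set δ := (Real.pi * c₁) ^ 3 / 4 with hδ
  have δ0 : 0 < δ := by positivity
  have win : ∀ E, |E - g₂| ≤ δ → c₁ / 2 ≤ ρ x₂ E := by
    intro E hE
    have k := dos_holder hN hB hA h hρ x₂ g₂ E
    have p1 := dos_nonneg hN h hρ x₂ E
    set r := Real.pi * ρ x₂ g₂
    set r' := Real.pi * ρ x₂ E
    have hr : Real.pi * c₁ ≤ r := mul_le_mul_of_nonneg_left hb Real.pi_pos.le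
    have hr' : 0 ≤ r' := by positivity
    have k2 : |r' - r| * (Real.pi * c₁) ^ 2 ≤ (Real.pi * c₁ / 2) * (Real.pi * c₁) ^ 2 := by
      calc _ ≤ |r' - r| * (r + r') ^ 2 := by gcongr; linarith
        _ ≤ _ := k
        _ ≤ 2 * δ := by linarith
        _ = _ := by rw [hδ]; ring
    have k3 := le_of_mul_le_mul_right k2 (by positivity)
    have k4 := (abs_le.1 k3).1
    have k5 : Real.pi * (c₁ / 2) ≤ Real.pi * ρ x₂ E := by linarith
    exact le_of_mul_le_mul_left k5 Real.pi_pos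
  have ii : ∀ a b, IntervalIntegrable (ρ x₂) volume a b := fun a b => (cont x₂).intervalIntegrable a b
  have lower : c₁ / 2 * min δ |g₁ - g₂| ≤ |∫ t in g₂..g₁, ρ x₂ t| := by
    set d := min δ |g₁ - g₂| with hd
    have d0 : 0 ≤ d := le_min δ0.le (abs_nonneg _)
    have dδ : d ≤ δ := min_le_left _ _
    have dg : d ≤ |g₁ - g₂| := min_le_right _ _
    rcases le_total g₂ g₁ with hle | hle
    · rw [abs_of_nonneg (sub_nonneg.2 hle)] at dg
      have e := intervalIntegral.integral_add_adjacent_intervals (ii g₂ (g₂ + d)) (ii (g₂ + d) g₁)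
      have n : 0 ≤ ∫ t in (g₂ + d)..g₁, ρ x₂ t :=
        intervalIntegral.integral_nonneg (by linarith) fun t _ => dos_nonneg hN h hρ x₂ t
      have m := intervalIntegral.integral_mono_on (a := g₂) (b := g₂ + d) (f := fun _ => c₁ / 2)
        (g := ρ x₂) (μ := volume) (by linarith) (by simp) (ii _ _) (fun t ht => win t (by
          rw [abs_le]; constructor <;> linarith [ht.1, ht.2]))
      simp at m
      rw [← e]
      refine le_trans ?_ (le_abs_self _)
      linarith
    · rw [abs_sub_comm, abs_of_nonneg (sub_nonneg.2 hle)] at dg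
      have e := intervalIntegral.integral_add_adjacent_intervals (ii g₁ (g₂ - d)) (ii (g₂ - d) g₂)
      have n : 0 ≤ ∫ t in g₁..(g₂ - d), ρ x₂ t :=
        intervalIntegral.integral_nonneg (by linarith) fun t _ => dos_nonneg hN h hρ x₂ t
      have m := intervalIntegral.integral_mono_on (a := g₂ - d) (b := g₂) (f := fun _ => c₁ / 2)
        (g := ρ x₂) (μ := volume) (by linarith) (by simp) (ii _ _) (fun t ht => win t (by
          rw [abs_le]; constructor <;> linarith [ht.1, ht.2]))
      simp at m
      rw [intervalIntegral.integral_symm, abs_neg, ← e]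
      refine le_trans ?_ (le_abs_self _)
      linarith
  have h2 := lower.trans h1'
  have ε0 : 0 ≤ ε := by positivity
  rw [le_div_iff₀ Real.pi_pos] at h2
  rcases le_total δ |g₁ - g₂| with hc' | hc'
  · rw [min_eq_left hc'] at h2
    have : 0 < c₁ * δ := by positivity
    nlinarith
  · rw [min_eq_right hc'] at h2
    rw [div_mul_eq_mul_div, le_div_iff₀ (by positivity)]
    linarith
end dos
end sol

lemma hsq_ringed (N : ℕ) (A : Matrix (Fin N) (Fin N) ℂ) (hA : (ringed N A).IsHermitian) :
    hsq N (ringed N A) = ringedSq N A := by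
  have := hsq_eq N (ringed N A)
  rw [hA.eq] at this
  rw [ringedSq, this, Complex.ofReal_re]

lemma ntr_real (N : ℕ) (A : Matrix (Fin N) (Fin N) ℂ) (hA : A.IsHermitian) :
    ntr N A = ((ntr N A).re : ℂ) := by
  have := ntr_conjT N A
  rw [hA.eq] at this
  exact (Complex.conj_eq_iff_re.1 this.symm).symm

lemma ringed_herm (N : ℕ) (A : Matrix (Fin N) (Fin N) ℂ) (hA : A.IsHermitian) :
    (ringed N A).IsHermitian := by
  unfold ringed
  rw [ntr_real N A hA]
  refine hA.sub ?_
  rw [Matrix.IsHermitian]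
  simp

lemma hsq_le_opNorm (N : ℕ) (hN : 1 ≤ N) (A : Matrix (Fin N) (Fin N) ℂ) :
    hsq N A ≤ opNorm N A ^ 2 := by
  have col : ∀ j, ∑ i, ‖A i j‖ ^ 2 ≤ opNorm N A ^ 2 := by
    intro j
    have h1 := (LinearMap.toContinuousLinearMap (Matrix.toEuclideanLin A)).le_opNorm
      (EuclideanSpace.single j (1:ℂ))
    have h2 := pow_le_pow_left₀ (norm_nonneg _) h1 2
    rw [EuclideanSpace.norm_single, norm_one, mul_one, EuclideanSpace.norm_sq_eq] at h2
    simpa [opNorm, Matrix.toLpLin_apply] using h2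
  have hN' : (0:ℝ) < N := by positivity
  unfold hsq
  rw [Finset.sum_comm, inv_mul_le_iff₀ hN']
  calc _ ≤ ∑ j : Fin N, opNorm N A ^ 2 := Finset.sum_le_sum fun j _ => col j
    _ = _ := by simp

lemma hsq_ringed_le (N : ℕ) (hN : 1 ≤ N) (A : Matrix (Fin N) (Fin N) ℂ) (hA : A.IsHermitian) :
    hsq N (ringed N A) ≤ hsq N A := by
  have r := ntr_real N A hA
  have h := hsq_sub_conjT N A (((ntr N A).re : ℂ) • 1)
  have e : A - (((ntr N A).re : ℂ) • (1 : Matrix (Fin N) (Fin N) ℂ))ᴴ = ringed N A := by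
    unfold ringed
    conv_rhs => rw [r]
    simp
  have e2 : hsq N (((ntr N A).re : ℂ) • (1 : Matrix (Fin N) (Fin N) ℂ)) = (ntr N A).re ^ 2 := by
    have : hsq N (((ntr N A).re : ℂ) • (1 : Matrix (Fin N) (Fin N) ℂ)) 
        = (ntr N A).re ^ 2 * hsq N 1 := by
      unfold hsq
      simp only [Matrix.smul_apply, smul_eq_mul, norm_mul, mul_pow, ← Finset.mul_sum,
        Complex.norm_real, Real.norm_eq_abs, sq_abs]
      ring
    rw [this, hsq_one N hN, mul_one]
  rw [e, e2, mul_smul_comm, mul_one, ntr_smul, Complex.re_ofReal_mul] at h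
  nlinarith [sq_nonneg (ntr N A).re]

/-- **Perturbation of quantiles (Lemma 3.5).**
For any `c₁ > 0` there is `c* = c*(c₁) > 0` such that for `|x₁ - x₂| ≤ c*` and any index
`i` in the `c₁`-bulk for both parameters,
`|γ_i^{x₁} - γ_i^{x₂} - (x₁ - x₂)⟨A⟩| ≤ C'(|x₁ - x₂|⟨Å²⟩^{1/2} + |x₁ - x₂|²)`
with `C'` depending only on `c₁` and the model constants. -/
theorem quantile_perturbation
    (C₀ CA : ℝ) (hC₀ : 0 < C₀) (hCA : 0 < CA)
    (c₁ : ℝ) (hc₁ : 0 < c₁) :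
    ∃ cstar : ℝ, 0 < cstar ∧ ∃ C' : ℝ, 0 < C' ∧
    ∀ (N : ℕ), 1 ≤ N →
    ∀ (B A : Matrix (Fin N) (Fin N) ℂ),
      B.IsHermitian → opNorm N B ≤ C₀ → A.IsHermitian → opNorm N A ≤ CA →
    ∀ (Msol : ℝ → ℂ → Matrix (Fin N) (Fin N) ℂ) (ρ : ℝ → ℝ → ℝ) (γ : ℝ → ℕ → ℝ),
      IsMDESol N B A Msol → IsSCDos N Msol ρ → IsQuantile N ρ γ →
    ∀ (x₁ x₂ : ℝ) (i : ℕ),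
      |x₁ - x₂| ≤ cstar → 1 ≤ i → i ≤ N →
      c₁ ≤ ρ x₁ (γ x₁ i) → c₁ ≤ ρ x₂ (γ x₂ i) →
      |γ x₁ i - γ x₂ i - (x₁ - x₂) * (ntr N A).re|
        ≤ C' * (|x₁ - x₂| * Real.sqrt (ringedSq N A) + |x₁ - x₂|^2) := by
  have hδ : 0 < (Real.pi * c₁) ^ 3 / 4 := by positivity
  refine ⟨c₁ * ((Real.pi * c₁) ^ 3 / 4) / 4 / CA, by positivity, 4 / (Real.pi * c₁),
    by positivity, ?_⟩
  intro N hN B A hB _ hA hAn Msol ρ γ hM hρ hγ x₁ x₂ i hx hi1 hi2 _ hb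
  set a := (ntr N A).re with ha
  have har : ntr N A = (a : ℂ) := ntr_real N A hA
  have hrA := ringed_herm N A hA
  have hM' : IsMDESol N B (ringed N A) (fun x z => Msol x (z + ((x * a : ℝ) : ℂ))) := by
    intro x z hz
    have hz' : 0 < (z + ((x * a : ℝ) : ℂ)).im := by simpa using hz
    obtain ⟨h1, h2⟩ := hM x _ hz'
    refine ⟨?_, h2⟩
    simp only
    rw [h1, ringed, har, smul_sub, add_smul]
    have : ((x * a : ℝ) : ℂ) • (1 : Matrix (Fin N) (Fin N) ℂ) = x • ((a : ℂ) • 1) := by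
      rw [← Complex.coe_smul, smul_smul]; push_cast; rfl
    rw [this]; abel
  have hρ' : IsSCDos N (fun x z => Msol x (z + ((x * a : ℝ) : ℂ))) (fun x E => ρ x (E + x * a)) := by
    intro x E
    refine (hρ x (E + x * a)).congr fun η => ?_
    have : ((E + x * a : ℝ) : ℂ) + η * Complex.I = E + η * Complex.I + ((x * a : ℝ) : ℂ) := by
      push_cast; ring
    rw [this]
  have hsh : ∀ x : ℝ, ∫ t in Set.Iic (γ x i - x * a), ρ x (t + x * a) = (i : ℝ) / N := by
    intro x
    have := (measurePreserving_add_right volume (x * a)).setIntegral_preimage_emb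
      (measurableEmbedding_addRight (x * a)) (ρ x) (Set.Iic (γ x i))
    rw [Set.preimage_add_const_Iic] at this
    rw [this, hγ x i hi1 hi2]
  have hq : (0:ℝ) < (i : ℝ) / N := by positivity
  have hsq0 : Real.sqrt (hsq N (ringed N A)) ≤ CA := by
    have h0 : 0 ≤ opNorm N A := norm_nonneg _
    refine (Real.sqrt_le_sqrt ((hsq_ringed_le N hN A hA).trans (hsq_le_opNorm N hN A))).trans ?_
    rwa [Real.sqrt_sq h0]
  have hs : |x₂ - x₁| * Real.sqrt (hsq N (ringed N A)) ≤ c₁ * ((Real.pi * c₁) ^ 3 / 4) / 4 := by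
    rw [abs_sub_comm]
    rw [le_div_iff₀ hCA] at hx
    exact (mul_le_mul_of_nonneg_left hsq0 (abs_nonneg _)).trans hx
  have fin := core hN hB hrA hM' hρ' c₁ hc₁ x₁ x₂ (γ x₁ i - x₁ * a) (γ x₂ i - x₂ * a) _ hq
    (hsh x₁) (hsh x₂) (by simpa using hb) hs
  rw [hsq_ringed N A hrA, abs_sub_comm x₂ x₁] at fin
  have e : γ x₁ i - γ x₂ i - (x₁ - x₂) * a = γ x₁ i - x₁ * a - (γ x₂ i - x₂ * a) := by ring
  rw [e]
  refine fin.trans ?_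
  have : 0 < 4 / (Real.pi * c₁) := by positivity
  gcongr
  linarith [sq_nonneg |x₁ - x₂|]

end
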